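/- arXiv:2304.02918 — 2 statements merged into one kernel-verified Lean document; each statement's English description precedes it below -/
import Mathlib

section
/- For t, ε > 0 and an integer n ≥ 2, the function H_n attains a global minimum over the open cube (0,1)^{n−1} at a unique point, and this minimizer is the unique critical point of H_n in (0,1)^{n−1}, i.e. the unique point of (0,1)^{n−1} at which the gradient ∇H_n vanishes. -/
/-- Extension of a vector `(a_0, …, a_{n-2})` to integer indices, with all
out-of-range values (in particular `a_{-1}` and `a_{n-1}`) set to `1`. -/
noncomputable def dpiiExt (n : ℕ) (a : Fin (n - 1) → ℝ) : ℤ → ℝ :=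
  fun j => if h : 0 ≤ j ∧ j < (n : ℤ) - 1 then a ⟨j.toNat, by omega⟩ else 1

/-- The Hamiltonian `H_n(a) = -∑_{k=0}^{n-2} ((k+ε)/t) log(1-a_k²) - ∑_{k=-1}^{n-2} a_k a_{k+1}`
with the convention `a_{-1} = a_{n-1} = 1`. -/
noncomputable def dpiiHam (n : ℕ) (t ε : ℝ) (a : Fin (n - 1) → ℝ) : ℝ :=
  -(∑ k ∈ Finset.range (n - 1), (((k : ℝ) + ε) / t) * Real.log (1 - (dpiiExt n a (k : ℤ)) ^ 2))
    - ∑ k ∈ Finset.range n, dpiiExt n a ((k : ℤ) - 1) * dpiiExt n a (k : ℤ)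

lemma dpiiExt_natCast (n : ℕ) (a : Fin (n - 1) → ℝ) (k : Fin (n - 1)) :
    dpiiExt n a ((k : ℕ) : ℤ) = a k := by
  have hk := k.2
  have h : (0 : ℤ) ≤ ((k : ℕ) : ℤ) ∧ ((k : ℕ) : ℤ) < (n : ℤ) - 1 := by omega
  rw [dpiiExt, dif_pos h]
  rfl

lemma dpiiExt_of_not_mem {n : ℕ} (a : Fin (n - 1) → ℝ) {j : ℤ}
    (h : ¬ (0 ≤ j ∧ j < (n : ℤ) - 1)) : dpiiExt n a j = 1 :=
  dif_neg h

/-- Every value of the extension is either a coordinate of the vector or the constant `1`. -/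
lemma exists_dpiiExt_eq_or (n : ℕ) (j : ℤ) :
    (∃ k : Fin (n - 1), j = ((k : ℕ) : ℤ) ∧ ∀ a : Fin (n - 1) → ℝ, dpiiExt n a j = a k) ∨
      ∀ a : Fin (n - 1) → ℝ, dpiiExt n a j = 1 := by
  by_cases h : 0 ≤ j ∧ j < (n : ℤ) - 1
  · have hj : j = ((j.toNat : ℕ) : ℤ) := by omega
    exact Or.inl ⟨⟨j.toNat, by omega⟩, hj, fun a => dif_pos h⟩
  · exact Or.inr fun a => dif_neg h

lemma dpiiExt_update (n : ℕ) (a : Fin (n - 1) → ℝ) (k : Fin (n - 1)) (s : ℝ) (j : ℤ) :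
    dpiiExt n (Function.update a k s) j
      = if j = ((k : ℕ) : ℤ) then s else dpiiExt n a j := by
  rcases exists_dpiiExt_eq_or n j with ⟨l, rfl, hl⟩ | h
  · simp only [hl, Function.update_apply, Fin.ext_iff, Nat.cast_inj]
  · have hjk : j ≠ ((k : ℕ) : ℤ) ∨ s = 1 := by
      refine or_iff_not_imp_left.2 fun hj => ?_
      have h1 := h (Function.update a k s)
      rw [not_not.1 hj, dpiiExt_natCast] at h1
      simpa using h1
    rcases hjk with hj | rfl
    · rw [h, h, if_neg hj]
    · rw [h, h, ite_self]

lemma differentiable_dpiiExt (n : ℕ) (j : ℤ) :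
    Differentiable ℝ fun a : Fin (n - 1) → ℝ => dpiiExt n a j := by
  rcases exists_dpiiExt_eq_or n j with ⟨k, -, hk⟩ | h
  · simp only [hk]
    fun_prop
  · simp only [h]
    fun_prop

lemma one_sub_sq_pos {x : ℝ} (h : 0 ≤ x ∧ x < 1) : 0 < 1 - x ^ 2 := by
  nlinarith [h.1, h.2]

lemma differentiableAt_dpiiHam (n : ℕ) (t ε : ℝ) {a : Fin (n - 1) → ℝ}
    (ha : ∀ k, 0 ≤ a k ∧ a k < 1) : DifferentiableAt ℝ (dpiiHam n t ε) a := by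
  have hE : ∀ j : ℤ, DifferentiableAt ℝ (fun b : Fin (n - 1) → ℝ => dpiiExt n b j) a :=
    fun j => (differentiable_dpiiExt n j).differentiableAt
  unfold dpiiHam
  refine DifferentiableAt.sub (DifferentiableAt.neg (DifferentiableAt.fun_sum fun k hk => ?_))
    (DifferentiableAt.fun_sum fun k _ => (hE _).mul (hE _))
  refine DifferentiableAt.const_mul (DifferentiableAt.log
    ((differentiableAt_const _).sub ((hE _).pow 2)) ?_) _
  have h := dpiiExt_natCast n a ⟨k, Finset.mem_range.1 hk⟩
  simp only at h
  change 1 - dpiiExt n a (k : ℤ) ^ 2 ≠ 0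
  rw [h]
  exact (one_sub_sq_pos (ha _)).ne'

/-- The partial derivative of `dpiiHam` in the `k`-th coordinate. -/
noncomputable def dpiiPartial (n : ℕ) (t ε : ℝ) (a : Fin (n - 1) → ℝ) (k : Fin (n - 1)) : ℝ :=
  (((k : ℕ) : ℝ) + ε) / t * (2 * a k / (1 - a k ^ 2))
    - (dpiiExt n a (((k : ℕ) : ℤ) - 1) + dpiiExt n a (((k : ℕ) : ℤ) + 1))

lemma hasDerivAt_dpiiHam_update (n : ℕ) (t ε : ℝ) {a : Fin (n - 1) → ℝ} (k : Fin (n - 1))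
    (ha : ∀ k, 0 ≤ a k ∧ a k < 1) :
    HasDerivAt (fun s => dpiiHam n t ε (Function.update a k s)) (dpiiPartial n t ε a k) (a k) := by
  have hk := k.2
  have hE : ∀ j : ℤ, HasDerivAt (fun s => dpiiExt n (Function.update a k s) j)
      (if j = ((k : ℕ) : ℤ) then 1 else 0) (a k) := by
    intro j
    simp only [dpiiExt_update]
    split_ifs
    · exact hasDerivAt_id _
    · exact hasDerivAt_const _ _
  unfold dpiiHam
  have hlog : ∀ j ∈ Finset.range (n - 1), HasDerivAt
      (fun s => ((j : ℝ) + ε) / t *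
        Real.log (1 - (dpiiExt n (Function.update a k s) (j : ℤ)) ^ 2))
      (if j = (k : ℕ) then -((j : ℝ) + ε) / t * (2 * a k / (1 - a k ^ 2)) else 0) (a k) := by
    intro j hj
    have hext := dpiiExt_natCast n a ⟨j, Finset.mem_range.1 hj⟩
    simp only at hext
    have hne : 1 - (dpiiExt n (Function.update a k (a k)) (j : ℤ)) ^ 2 ≠ 0 := by
      rw [Function.update_eq_self, hext]
      exact (one_sub_sq_pos (ha _)).ne'
    refine (((((hE j).fun_pow 2).const_sub 1).log hne).const_mul
      (((j : ℝ) + ε) / t)).congr_deriv ?_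
    by_cases h : j = (k : ℕ)
    · subst h
      simp only [Function.update_eq_self, dpiiExt_natCast, if_true]
      push_cast
      ring
    · have h' : ¬ ((j : ℤ) = ((k : ℕ) : ℤ)) := by exact_mod_cast h
      simp [h, h']
  refine ((HasDerivAt.fun_sum hlog).fun_neg.fun_sub (HasDerivAt.fun_sum (u := Finset.range n)
    fun j _ => (hE ((j : ℤ) - 1)).fun_mul (hE (j : ℤ)))).congr_deriv ?_
  have e1 : ∀ j : ℕ, ((j : ℤ) - 1 = ((k : ℕ) : ℤ)) ↔ j = (k : ℕ) + 1 := by intro j; omega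
  simp only [Function.update_eq_self, Finset.sum_add_distrib, e1, Nat.cast_inj, ite_mul, mul_ite,
    one_mul, zero_mul, mul_one, mul_zero, Finset.sum_ite_eq', Finset.mem_range]
  rw [if_pos (by omega), if_pos (by omega), if_pos (by omega), dpiiPartial]
  push_cast
  ring

lemma dpiiPartial_eq_zero_of_fderiv (n : ℕ) (t ε : ℝ) {a : Fin (n - 1) → ℝ}
    (ha : ∀ k, 0 ≤ a k ∧ a k < 1) (h : fderiv ℝ (dpiiHam n t ε) a = 0) (k : Fin (n - 1)) :
    dpiiPartial n t ε a k = 0 := by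
  have h1 : HasFDerivAt (dpiiHam n t ε) (0 : (Fin (n - 1) → ℝ) →L[ℝ] ℝ)
      (Function.update a k (a k)) := by
    rw [Function.update_eq_self, ← h]
    exact (differentiableAt_dpiiHam n t ε ha).hasFDerivAt
  have h2 := h1.comp_hasDerivAt (a k) (hasDerivAt_update a k (a k))
  simpa using (hasDerivAt_dpiiHam_update n t ε k ha).unique h2

/-- Comparison of critical points: look at the coordinate where the ratio `b k / a k` is
largest and use that `x ↦ 1 / (1 - x ^ 2)` is strictly increasing on `(0, 1)`. -/
lemma le_of_dpiiPartial_eq_zero (n : ℕ) {t ε : ℝ} (ht : 0 < t) (hε : 0 < ε)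
    {a b : Fin (n - 1) → ℝ} (ha : ∀ k, a k ∈ Set.Ioo (0 : ℝ) 1)
    (hb : ∀ k, b k ∈ Set.Ioo (0 : ℝ) 1) (hca : ∀ k, dpiiPartial n t ε a k = 0)
    (hcb : ∀ k, dpiiPartial n t ε b k = 0) (k : Fin (n - 1)) : b k ≤ a k := by
  have : Nonempty (Fin (n - 1)) := ⟨k⟩
  obtain ⟨m, hm⟩ := Finite.exists_max fun k => b k / a k
  set r := b m / a m with hr
  by_contra! hlt
  have hr1 : 1 < r := lt_of_lt_of_le ((one_lt_div (ha k).1).2 hlt) (hm k)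
  have hbm : b m = r * a m := by rw [hr, div_mul_cancel₀ _ (ha m).1.ne']
  have hE : ∀ j, dpiiExt n b j ≤ r * dpiiExt n a j := by
    intro j
    rcases exists_dpiiExt_eq_or n j with ⟨l, -, hl⟩ | h
    · rw [hl, hl]
      exact (div_le_iff₀ (ha l).1).1 (hm l)
    · rw [h, h]
      linarith
  have hc : 0 < (((m : ℕ) : ℝ) + ε) / t := by positivity
  have ham := one_sub_sq_pos ⟨(ha m).1.le, (ha m).2⟩
  have hbm' := one_sub_sq_pos ⟨(hb m).1.le, (hb m).2⟩
  have hab : a m < b m := by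
    rw [hbm]
    nlinarith [(ha m).1]
  have hsq : 1 - b m ^ 2 < 1 - a m ^ 2 := by nlinarith [(ha m).1]
  have hg : r * (2 * a m / (1 - a m ^ 2)) < 2 * b m / (1 - b m ^ 2) := by
    have h1 : r * (2 * a m / (1 - a m ^ 2)) = 2 * b m / (1 - a m ^ 2) := by
      rw [hbm]; ring
    rw [h1]
    exact div_lt_div_of_pos_left (by linarith [(hb m).1]) hbm' hsq
  have h1 := hca m
  have h2 := hcb m
  unfold dpiiPartial at h1 h2
  have h3 := mul_lt_mul_of_pos_left hg hc
  have h4 := hE (((m : ℕ) : ℤ) - 1)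
  have h5 := hE (((m : ℕ) : ℤ) + 1)
  have h6 : r * ((((m : ℕ) : ℝ) + ε) / t * (2 * a m / (1 - a m ^ 2)))
      = r * (dpiiExt n a (((m : ℕ) : ℤ) - 1) + dpiiExt n a (((m : ℕ) : ℤ) + 1)) := by
    rw [sub_eq_zero.1 h1]
  linarith

lemma eq_of_fderiv_dpiiHam_eq_zero (n : ℕ) {t ε : ℝ} (ht : 0 < t) (hε : 0 < ε)
    {a b : Fin (n - 1) → ℝ} (ha : ∀ k, a k ∈ Set.Ioo (0 : ℝ) 1)
    (hb : ∀ k, b k ∈ Set.Ioo (0 : ℝ) 1) (hca : fderiv ℝ (dpiiHam n t ε) a = 0)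
    (hcb : fderiv ℝ (dpiiHam n t ε) b = 0) : b = a := by
  have hca' := dpiiPartial_eq_zero_of_fderiv n t ε (fun k => ⟨(ha k).1.le, (ha k).2⟩) hca
  have hcb' := dpiiPartial_eq_zero_of_fderiv n t ε (fun k => ⟨(hb k).1.le, (hb k).2⟩) hcb
  exact funext fun k => le_antisymm (le_of_dpiiPartial_eq_zero n ht hε ha hb hca' hcb' k)
    (le_of_dpiiPartial_eq_zero n ht hε hb ha hcb' hca' k)

/-- First-order condition for a minimum on an interval. -/
lemma IsMinOn.mul_sub_nonneg_of_hasDerivAt {f : ℝ → ℝ} {f' x y l r : ℝ}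
    (hmin : IsMinOn f (Set.Icc l r) x) (hf : HasDerivAt f f' x) (hx : x ∈ Set.Icc l r)
    (hy : y ∈ Set.Icc l r) : 0 ≤ f' * (y - x) := by
  have h := hmin.localize.hasFDerivWithinAt_nonneg hf.hasFDerivAt.hasFDerivWithinAt
    (sub_mem_posTangentConeAt_of_segment_subset ((convex_Icc l r).segment_subset hx hy))
  simpa [mul_comm] using h

/-- On a large enough closed box the minimum is attained in the interior. -/
lemma exists_isMinOn_dpiiHam_Icc (n : ℕ) {t ε r : ℝ} (ht : 0 < t) (hε : 0 < ε)
    (hr0 : 1 / 2 ≤ r) (hr : 1 - ε / t / 4 < r) (hr1 : r < 1) :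
    ∃ a : Fin (n - 1) → ℝ, (∀ k, a k ∈ Set.Ioo (0 : ℝ) r) ∧
      IsMinOn (dpiiHam n t ε) (Set.Icc (fun _ => 0) fun _ => r) a := by
  have hlt : ∀ a ∈ Set.Icc (fun _ : Fin (n - 1) => (0 : ℝ)) (fun _ => r),
      ∀ k, 0 ≤ a k ∧ a k < 1 := fun a ha k => ⟨ha.1 k, (ha.2 k).trans_lt hr1⟩
  obtain ⟨a, ha, hmin⟩ := (isCompact_Icc (a := fun _ : Fin (n - 1) => (0 : ℝ))
    (b := fun _ => r)).exists_isMinOn ⟨fun _ => 0, le_rfl, fun _ => by simp only; linarith⟩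
    (f := dpiiHam n t ε)
    fun a ha => (differentiableAt_dpiiHam n t ε (hlt a ha)).continuousAt.continuousWithinAt
  refine ⟨a, ?_, hmin⟩
  have hfirst : ∀ k, ∀ y ∈ Set.Icc (0 : ℝ) r, 0 ≤ dpiiPartial n t ε a k * (y - a k) := by
    intro k y hy
    refine IsMinOn.mul_sub_nonneg_of_hasDerivAt (l := 0) (r := r) ?_
      (hasDerivAt_dpiiHam_update n t ε k (hlt a ha)) ⟨ha.1 k, ha.2 k⟩ hy
    intro s hs
    simp only [Set.mem_ofPred_eq, Function.update_eq_self]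
    refine hmin ⟨fun j => ?_, fun j => ?_⟩
    · by_cases hj : j = k
      · subst hj; simpa using hs.1
      · simpa [hj] using ha.1 j
    · by_cases hj : j = k
      · subst hj; simpa using hs.2
      · simpa [hj] using ha.2 j
  have hE0 : ∀ j, 0 ≤ dpiiExt n a j := by
    intro j
    rcases exists_dpiiExt_eq_or n j with ⟨l, -, hl⟩ | h
    · rw [hl]; exact ha.1 l
    · rw [h]; exact zero_le_one
  have hE1 : ∀ j, dpiiExt n a j ≤ 1 := by
    intro j
    rcases exists_dpiiExt_eq_or n j with ⟨l, -, hl⟩ | h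
    · rw [hl]; exact (hlt a ha l).2.le
    · rw [h]
  have hpos : ∀ i : ℕ, 0 < dpiiExt n a ((i : ℤ) - 1) := by
    intro i
    induction i with
    | zero => rw [dpiiExt_of_not_mem a (by omega)]; exact one_pos
    | succ i ih =>
      rw [show ((i + 1 : ℕ) : ℤ) - 1 = (i : ℤ) by push_cast; ring]
      rcases exists_dpiiExt_eq_or n (i : ℤ) with ⟨l, hil, hl⟩ | h
      · rw [hl]
        refine lt_of_le_of_ne (ha.1 l) fun h0 => ?_
        have h1 := hfirst l r ⟨by linarith, le_rfl⟩
        have h2 := hE0 (((l : ℕ) : ℤ) + 1)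
        rw [hil] at ih
        rw [dpiiPartial, ← h0] at h1
        simp only [mul_zero, zero_div, zero_sub, sub_zero] at h1
        nlinarith
      · rw [h]; exact one_pos
  intro k
  refine ⟨?_, lt_of_le_of_ne (ha.2 k) fun h0 => ?_⟩
  · have h := hpos ((k : ℕ) + 1)
    rwa [show (((k : ℕ) + 1 : ℕ) : ℤ) - 1 = ((k : ℕ) : ℤ) by push_cast; ring,
      dpiiExt_natCast] at h
  · have h1 := hfirst k 0 ⟨le_rfl, by linarith⟩
    have h2 := hE1 (((k : ℕ) : ℤ) - 1)
    have h3 := hE1 (((k : ℕ) : ℤ) + 1)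
    have hsq : 0 < 1 - r ^ 2 := by nlinarith
    have hc : ε / t ≤ (((k : ℕ) : ℝ) + ε) / t := by
      gcongr
      linarith [Nat.cast_nonneg (α := ℝ) (k : ℕ)]
    have hc0 : 0 < ε / t := by positivity
    have h4 : 2 < (((k : ℕ) : ℝ) + ε) / t * (2 * r / (1 - r ^ 2)) := by
      rw [← mul_div_assoc, lt_div_iff₀ hsq]
      nlinarith
    rw [dpiiPartial, h0] at h1
    nlinarith

/-- A minimizer over an open cube `(0, r)^(n-1)` is a critical point. -/
lemma fderiv_dpiiHam_eq_zero_of_forall_le (n : ℕ) {t ε r : ℝ} {a : Fin (n - 1) → ℝ}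
    (ha : ∀ k, a k ∈ Set.Ioo (0 : ℝ) r)
    (hmin : ∀ c : Fin (n - 1) → ℝ, (∀ k, c k ∈ Set.Ioo (0 : ℝ) r) →
      dpiiHam n t ε a ≤ dpiiHam n t ε c) : fderiv ℝ (dpiiHam n t ε) a = 0 := by
  refine IsLocalMin.fderiv_eq_zero ?_
  have hmem : Set.univ.pi (fun _ : Fin (n - 1) => Set.Ioo (0 : ℝ) r) ∈ nhds a :=
    (isOpen_set_pi Set.finite_univ fun _ _ => isOpen_Ioo).mem_nhds fun k _ => ha k
  filter_upwards [hmem] with c hc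
  exact hmin c fun k => hc k (Set.mem_univ k)

/-- For `t, ε > 0` and `n ≥ 2`, the Hamiltonian `H_n` attains a global minimum over the
open cube `(0,1)^{n-1}` at a unique point, and this minimizer is the unique critical
point (zero of the gradient) of `H_n` in `(0,1)^{n-1}`. -/
theorem dpiiHam_unique_min_and_critical (t ε : ℝ) (ht : 0 < t) (hε : 0 < ε)
    (n : ℕ) (hn : 2 ≤ n) :
    ∃ a : Fin (n - 1) → ℝ,
      (∀ k, a k ∈ Set.Ioo (0 : ℝ) 1) ∧
      (∀ b : Fin (n - 1) → ℝ, (∀ k, b k ∈ Set.Ioo (0 : ℝ) 1) →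
        dpiiHam n t ε a ≤ dpiiHam n t ε b) ∧
      fderiv ℝ (dpiiHam n t ε) a = 0 ∧
      (∀ b : Fin (n - 1) → ℝ, (∀ k, b k ∈ Set.Ioo (0 : ℝ) 1) →
        (∀ c : Fin (n - 1) → ℝ, (∀ k, c k ∈ Set.Ioo (0 : ℝ) 1) →
          dpiiHam n t ε b ≤ dpiiHam n t ε c) → b = a) ∧
      (∀ b : Fin (n - 1) → ℝ, (∀ k, b k ∈ Set.Ioo (0 : ℝ) 1) →
        fderiv ℝ (dpiiHam n t ε) b = 0 → b = a) := by
  obtain ⟨R, hR, hR1⟩ : ∃ R : ℝ, max (1 / 2) (1 - ε / t / 4) < R ∧ R < 1 :=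
    exists_between (max_lt (by norm_num) (by have : 0 < ε / t := by positivity
                                             linarith))
  have hbox : ∀ s : ℝ, R ≤ s → s < 1 → ∃ a : Fin (n - 1) → ℝ,
      (∀ k, a k ∈ Set.Ioo (0 : ℝ) 1) ∧ fderiv ℝ (dpiiHam n t ε) a = 0 ∧
      IsMinOn (dpiiHam n t ε) (Set.Icc (fun _ => 0) fun _ => s) a := by
    intro s hs hs1
    obtain ⟨a, ha, hmin⟩ := exists_isMinOn_dpiiHam_Icc n ht hε
      ((le_max_left _ _).trans (hR.le.trans hs))
      ((le_max_right _ _).trans_lt (hR.trans_le hs)) hs1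
    exact ⟨a, fun k => ⟨(ha k).1, (ha k).2.trans hs1⟩,
      fderiv_dpiiHam_eq_zero_of_forall_le n ha fun c hc =>
        hmin ⟨fun k => (hc k).1.le, fun k => (hc k).2.le⟩, hmin⟩
  obtain ⟨a, ha, hcrit, -⟩ := hbox R le_rfl hR1
  refine ⟨a, ha, fun b hb => ?_, hcrit, fun b hb hmin => ?_, fun b hb hcb =>
    eq_of_fderiv_dpiiHam_eq_zero n ht hε ha hb hcrit hcb⟩
  · have : Nonempty (Fin (n - 1)) := ⟨⟨0, by omega⟩⟩
    obtain ⟨m, hm⟩ := Finite.exists_max b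
    obtain ⟨c, hc, hcc, hmin⟩ := hbox (max R (b m)) (le_max_left _ _) (max_lt hR1 (hb m).2)
    rw [← eq_of_fderiv_dpiiHam_eq_zero n ht hε ha hc hcrit hcc]
    exact hmin ⟨fun k => (hb k).1.le, fun k => (hm k).trans (le_max_right _ _)⟩
  · exact eq_of_fderiv_dpiiHam_eq_zero n ht hε ha hb hcrit
      (fderiv_dpiiHam_eq_zero_of_forall_le n hb hmin)
end

section
/- Let u₀ : ℝ → ℝ be twice differentiable with u₀''(x) = 2x·u₀(x) + 2u₀(x)³ for all x ∈ ℝ, u₀(x) > 0 for all x, u₀ strictly decreasing, u₀(x) − √(−x) → 0 and u₀'(x) → 0 as x → −∞, and s ↦ u₀(s)² + s absolutely integrable on (−∞, x] for every x. Let ω ∈ (−∞, +∞] and let u : (−∞, ω) → ℝ be twice differentiable with u''(x) = 2x·u(x) + 2u(x)³ for all x < ω, u(x) ≥ u₀(x) for all x < ω, u(x) − √(−x) → 0 and u'(x) → 0 as x → −∞, u'(x) < 0 for all sufficiently negative x, and s ↦ u(s)² + s absolutely integrable on (−∞, x] for every x < ω. Then for all x < min(ω, 0): u(x) > √(−x/3)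 and u(x) ≥ √(−x)·√((√(1−4x³) − 1)/(√(1−4x³) + 1)). -/
open Filter MeasureTheory Topology

/-- A twice differentiable function has nonnegative second derivative at a local minimum. -/
lemma IsLocalMin.second_deriv_nonneg {f f' : ℝ → ℝ} {a c : ℝ} (hmin : IsLocalMin f a)
    (hf : ∀ᶠ x in 𝓝 a, HasDerivAt f (f' x) x) (hf' : HasDerivAt f' c a) : 0 ≤ c := by
  by_contra! hc
  have hd : deriv f =ᶠ[𝓝 a] f' := hf.mono fun x hx => hx.deriv
  have h2 : deriv (deriv f) a = c := by rw [hd.deriv_eq, hf'.deriv]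
  have hmax : IsLocalMax f a :=
    isLocalMax_of_deriv_deriv_neg (by rw [h2]; exact hc) hmin.deriv_eq_zero
      hf.self_of_nhds.continuousAt
  have hconst : f =ᶠ[𝓝 a] fun _ => f a := by
    filter_upwards [hmin, hmax] with x h1 h2 using le_antisymm h2 h1
  have h3 := hconst.deriv.deriv_eq
  simp only [deriv_const'] at h3
  rw [h2] at h3
  linarith

/-- If `u` is decreasing, positive and asymptotic to `√(-x)` at `-∞`, and `0 < m ≤ √(-x)` on
`(-∞, 0)` with `m` above `u` somewhere, then `u / m` attains its minimum over `(-∞, 0)`. -/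
lemma exists_forall_div_le_div {u m : ℝ → ℝ} (hu : Continuous u) (hpos : ∀ x, 0 < u x)
    (hanti : StrictAnti u)
    (hasymp : Tendsto (fun x : ℝ => u x - Real.sqrt (-x)) atBot (𝓝 0))
    (hm : ContinuousOn m (Set.Iio 0)) (hm0 : ∀ x < 0, 0 < m x)
    (hm1 : ∀ x < 0, m x ≤ Real.sqrt (-x)) {x₁ : ℝ} (hx₁ : x₁ < 0) (h : u x₁ < m x₁) :
    ∃ x₀ < 0, ∀ y < 0, u x₀ / m x₀ ≤ u y / m y := by
  set c := u x₁ / m x₁ with hc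
  have hc0 : 0 < c := div_pos (hpos _) (hm0 _ hx₁)
  have hc1 : c < 1 := (div_lt_one (hm0 _ hx₁)).2 h
  have hsqrt : Tendsto (fun x : ℝ => Real.sqrt (-x)) atBot atTop :=
    Real.tendsto_sqrt_atTop.comp tendsto_neg_atBot_atTop
  have hev : ∀ᶠ x in atBot, c * Real.sqrt (-x) ≤ u x := by
    filter_upwards [hasymp.eventually (lt_mem_nhds (show (-1 : ℝ) < 0 by norm_num)),
      hsqrt.eventually_ge_atTop (1 / (1 - c))] with x h1 h2
    rw [div_le_iff₀ (by linarith)] at h2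
    linarith
  obtain ⟨M, hM⟩ := eventually_atBot.1 hev
  set δ := (u 0 / c) ^ 2 with hδ
  have hδ0 : 0 < δ := pow_pos (div_pos (hpos 0) hc0) 2
  have hK : Set.Icc (min M x₁) (max (-δ) x₁) ⊆ Set.Iio 0 := fun x hx =>
    lt_of_le_of_lt hx.2 (max_lt (by linarith) hx₁)
  have hmem : x₁ ∈ Set.Icc (min M x₁) (max (-δ) x₁) := ⟨min_le_right _ _, le_max_right _ _⟩
  obtain ⟨x₀, hx₀, hmin⟩ := isCompact_Icc.exists_isMinOn ⟨x₁, hmem⟩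
    (hu.continuousOn.div (hm.mono hK) fun x hx => (hm0 x (hK hx)).ne')
  have hle : u x₀ / m x₀ ≤ c := hmin hmem
  refine ⟨x₀, hK hx₀, fun y hy => ?_⟩
  by_cases hyK : y ∈ Set.Icc (min M x₁) (max (-δ) x₁)
  · exact hmin hyK
  refine hle.trans ((le_div_iff₀ (hm0 y hy)).2 ?_)
  refine (mul_le_mul_of_nonneg_left (hm1 y hy) hc0.le).trans ?_
  rcases lt_or_ge y (min M x₁) with h1 | h1
  · exact hM y (h1.le.trans (min_le_left _ _))
  · have h2 : max (-δ) x₁ < y := by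
      by_contra! h2
      exact hyK ⟨h1, h2⟩
    have h3 : -y ≤ δ := by linarith [(le_max_left (-δ) x₁).trans_lt h2]
    have h4 : Real.sqrt (-y) ≤ u 0 / c := Real.sqrt_le_iff.2 ⟨(div_pos (hpos 0) hc0).le, h3⟩
    have h5 := mul_le_mul_of_nonneg_left h4 hc0.le
    rw [mul_div_cancel₀ _ hc0.ne'] at h5
    exact h5.trans (hanti hy).le

/-- First and second order conditions at a minimum of the quotient `u / m`. -/
lemma deriv_conditions_of_forall_div_le_div {u u' m m' : ℝ → ℝ} {x₀ a b : ℝ}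
    (hu : ∀ x, HasDerivAt u (u' x) x) (hu' : HasDerivAt u' a x₀)
    (hm0 : ∀ x < 0, 0 < m x) (hm : ∀ x < 0, HasDerivAt m (m' x) x) (hm' : HasDerivAt m' b x₀)
    (hx₀ : x₀ < 0) (hmin : ∀ y < 0, u x₀ / m x₀ ≤ u y / m y) :
    u' x₀ = u x₀ / m x₀ * m' x₀ ∧ u x₀ / m x₀ * b ≤ a := by
  set l := u x₀ / m x₀ with hl
  have hev : ∀ᶠ y in 𝓝 x₀, y < 0 := Iio_mem_nhds hx₀
  have hloc : IsLocalMin (fun x => u x - l * m x) x₀ := by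
    filter_upwards [hev] with y hy
    have h1 := (le_div_iff₀ (hm0 y hy)).1 (hmin y hy)
    have h2 : l * m x₀ = u x₀ := div_mul_cancel₀ _ (hm0 x₀ hx₀).ne'
    linarith
  have hd : ∀ x < 0, HasDerivAt (fun x => u x - l * m x) (u' x - l * m' x) x := fun x hx =>
    (hu x).sub ((hm x hx).const_mul l)
  have h1 := hloc.hasDerivAt_eq_zero (hd x₀ hx₀)
  have h2 := hloc.second_deriv_nonneg (hev.mono hd) (hu'.sub (hm'.const_mul l))
  constructor <;> linarith

lemma hasDerivAt_sqrt_neg {x : ℝ} (hx : x < 0) :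
    HasDerivAt (fun x : ℝ => Real.sqrt (-x)) (-(1 / (2 * Real.sqrt (-x)))) x := by
  convert (hasDerivAt_neg x).sqrt (by linarith) using 1
  ring

lemma hasDerivAt_deriv_sqrt_neg {x : ℝ} (hx : x < 0) :
    HasDerivAt (fun x : ℝ => -(1 / (2 * Real.sqrt (-x))))
      (-(1 / (4 * Real.sqrt (-x) ^ 3))) x := by
  have h0 : 0 < Real.sqrt (-x) := Real.sqrt_pos.2 (by linarith)
  simp only [one_div]
  refine (((hasDerivAt_sqrt_neg hx).const_mul 2).fun_inv (by positivity)).fun_neg.congr_deriv ?_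
  field_simp
  norm_num

/-- A positive solution of the equation `u'' = 2xu + 2u³` cannot start at `-t`, with `t³ ≤ 3/16`,
below `√(t/3)` with logarithmic derivative `-1/(2t)`, and be decreasing. -/
lemma false_of_small_initial_value {u u' u'' : ℝ → ℝ} {t : ℝ}
    (hd1 : ∀ x, HasDerivAt u (u' x) x) (hd2 : ∀ x, HasDerivAt u' (u'' x) x)
    (hode : ∀ x, u'' x = 2 * x * u x + 2 * (u x) ^ 3) (hpos : ∀ x, 0 < u x)
    (hanti : StrictAnti u) (ht : 0 < t) (ht3 : t ^ 3 ≤ 3 / 16)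
    (hu : u (-t) ^ 2 ≤ t / 3) (hu' : u' (-t) = -(u (-t) / (2 * t))) : False := by
  set k := 2 / (5 * t) with hk
  have hk0 : 0 < k := by positivity
  have hkt : k * t = 2 / 5 := by rw [hk]; field_simp
  have hq : ∀ x, HasDerivAt (fun x => k * (x + t)) k x := fun x => by
    simpa using ((hasDerivAt_id x).add_const t).const_mul k
  have hw : ∀ x, HasDerivAt (fun x => 4 - 5 * (k * (x + t)) + (k * (x + t)) ^ 3)
      (k * (3 * (k * (x + t)) ^ 2 - 5)) x := fun x => 
    ((((hq x).const_mul 5).const_sub 4).fun_add ((hq x).fun_pow 3)).congr_deriv (by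
      norm_num
      ring)
  have hw' : ∀ x, HasDerivAt (fun x => k * (3 * (k * (x + t)) ^ 2 - 5))
      (6 * k ^ 2 * (k * (x + t))) x := fun x => 
    (((((hq x).fun_pow 2).const_mul 3).sub_const 5).const_mul k).congr_deriv (by
      norm_num
      ring)
  have hN := fun x => ((hd2 x).mul (hw x)).sub ((hd1 x).mul (hw' x))
  have hanti' := antitoneOn_of_hasDerivWithinAt_nonpos (convex_Icc (-t) (3 * t / 2))
    (fun x _ => (hN x).continuousAt.continuousWithinAt)
    (fun x _ => (hN x).hasDerivWithinAt) (fun x hx => by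
      rw [interior_Icc] at hx
      obtain ⟨q, hqx⟩ : ∃ q, q = k * (x + t) := ⟨_, rfl⟩
      have hx' : x = t * (5 * q / 2 - 1) := by
        rw [hqx, hk]; field_simp; ring
      have hq0 : 0 < q := by rw [hqx]; exact mul_pos hk0 (by linarith [hx.1])
      have hq1 : q < 1 := by
        have := mul_lt_mul_of_pos_left (show x + t < 5 * t / 2 by linarith [hx.2]) hk0
        rw [hqx]; linarith
      have hux : u x ^ 2 ≤ t / 3 :=
        (pow_le_pow_left₀ (hpos x).le (hanti hx.1).le 2).trans hu
      have hwp : 0 < 4 - 5 * q + q ^ 3 := by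
        have h1 : 0 < 4 - q - q ^ 2 := by nlinarith
        linarith [mul_pos (sub_pos.2 hq1) h1]
      have key : 2 * (u x ^ 2 + x) * (4 - 5 * q + q ^ 3) ≤ 6 * k ^ 2 * q := by
        have hs : u x ^ 2 + x ≤ t * (5 * q / 2 - 2 / 3) := by linarith
        rcases le_or_gt (5 * q / 2 - 2 / 3) 0 with hneg | hp
        · have h1 : u x ^ 2 + x ≤ 0 := hs.trans (mul_nonpos_of_nonneg_of_nonpos ht.le hneg)
          have h2 : 2 * (u x ^ 2 + x) * (4 - 5 * q + q ^ 3) ≤ 0 :=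
            mul_nonpos_of_nonpos_of_nonneg (by linarith) hwp.le
          exact h2.trans (by positivity)
        · have h1 : (3 / 8) * ((5 * q / 2 - 2 / 3) * (4 - 5 * q + q ^ 3)) ≤ 24 / 25 * q := by
            nlinarith [sq_nonneg (q - 1 / 2), mul_pos hq0 (sub_pos.2 hq1),
              mul_nonneg hq0.le (sq_nonneg (q - 1 / 2)), sq_nonneg (q ^ 2 - 1 / 4),
              sq_nonneg (q ^ 2 - q / 2)]
          have h2 : 2 * t ^ 3 * ((5 * q / 2 - 2 / 3) * (4 - 5 * q + q ^ 3)) ≤ 24 / 25 * q :=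
            (mul_le_mul_of_nonneg_right (by linarith) (mul_pos hp hwp).le).trans h1
          have h3 : 6 * k ^ 2 * q = 24 / 25 * q / t ^ 2 := by
            rw [hk]; field_simp; norm_num
          rw [h3, le_div_iff₀ (by positivity)]
          refine le_trans (le_of_eq_of_le ?_ (mul_le_mul_of_nonneg_right hs
            (show 0 ≤ 2 * (4 - 5 * q + q ^ 3) * t ^ 2 by positivity)))
            (le_of_eq_of_le ?_ h2) <;> ring
      rw [← hqx, hode]
      nlinarith [mul_le_mul_of_nonneg_left key (hpos x).le])
  have h := hanti' (Set.left_mem_Icc.2 (by linarith)) (Set.right_mem_Icc.2 (by linarith))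
    (by linarith : -t ≤ 3 * t / 2)
  have e1 : k * (3 * t / 2 + t) = 1 := by linarith
  have e2 : k * (-t + t) = 0 := by ring
  simp only [Pi.sub_apply, Pi.mul_apply, e1, e2, hu'] at h
  have e3 : -(u (-t) / (2 * t)) * 4 = - (u (-t) * (k * 5)) := by rw [hk]; field_simp; norm_num
  nlinarith [mul_pos (hpos (3 * t / 2)) hk0]

/-- The first lower bound for the Hastings–McLeod solution. -/
lemma sqrt_div_three_lt {u u' u'' : ℝ → ℝ}
    (hd1 : ∀ x, HasDerivAt u (u' x) x) (hd2 : ∀ x, HasDerivAt u' (u'' x) x)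
    (hode : ∀ x, u'' x = 2 * x * u x + 2 * (u x) ^ 3) (hpos : ∀ x, 0 < u x)
    (hanti : StrictAnti u)
    (hasymp : Tendsto (fun x : ℝ => u x - Real.sqrt (-x)) atBot (𝓝 0))
    {x : ℝ} (hx : x < 0) : Real.sqrt (-x / 3) < u x := by
  by_contra! hle
  have hm0 : ∀ y : ℝ, y < 0 → 0 < Real.sqrt (-y) := fun y hy => Real.sqrt_pos.2 (by linarith)
  have hlt : u x < Real.sqrt (-x) :=
    hle.trans_lt (Real.sqrt_lt_sqrt (by linarith) (by linarith))
  obtain ⟨x₀, hx₀, hmin⟩ := exists_forall_div_le_div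
    (continuous_iff_continuousAt.2 fun y => (hd1 y).continuousAt) hpos hanti hasymp
    (by fun_prop) hm0 (fun _ _ => le_rfl) hx hlt
  obtain ⟨h1, h2⟩ := deriv_conditions_of_forall_div_le_div hd1 (hd2 x₀) hm0
    (fun y hy => hasDerivAt_sqrt_neg hy) (hasDerivAt_deriv_sqrt_neg hx₀) hx₀ hmin
  obtain ⟨t, rfl⟩ : ∃ t, x₀ = -t := ⟨-x₀, by ring⟩
  have ht : 0 < t := by linarith
  have hr := hmin x hx
  simp only [neg_neg] at h1 h2 hr
  obtain ⟨r, hr'⟩ : ∃ r, r = Real.sqrt t := ⟨_, rfl⟩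
  have hr0 : 0 < r := by rw [hr']; exact Real.sqrt_pos.2 ht
  have hrt : r ^ 2 = t := by rw [hr']; exact Real.sq_sqrt ht.le
  rw [← hr'] at h1 h2 hr
  have hu2 : u (-t) ^ 2 ≤ t / 3 := by
    have h3 : u x ^ 2 ≤ -x / 3 := by
      have := pow_le_pow_left₀ (hpos x).le hle 2
      rwa [Real.sq_sqrt (by linarith)] at this
    have h4 := pow_le_pow_left₀ (div_pos (hpos _) hr0).le hr 2
    rw [div_pow, div_pow, Real.sq_sqrt (by linarith), hrt] at h4
    have h5 : u x ^ 2 / -x ≤ 1 / 3 := by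
      rw [div_le_iff₀ (by linarith)]; linarith
    have h6 := h4.trans h5
    rw [div_le_iff₀ ht] at h6
    linarith
  have hu' : u' (-t) = -(u (-t) / (2 * t)) := by
    rw [h1, ← hrt]; field_simp
  refine false_of_small_initial_value hd1 hd2 hode hpos hanti ht ?_ hu2 hu'
  have e : u (-t) / r * -(1 / (4 * r ^ 3)) = -(u (-t) / (4 * t ^ 2)) := by
    rw [← hrt]; field_simp
  rw [e, hode] at h2
  have h3 : -(1 / (4 * t ^ 2)) ≤ 2 * (u (-t) ^ 2 - t) := by
    refine le_of_mul_le_mul_left ?_ (hpos (-t))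
    calc _ = -(u (-t) / (4 * t ^ 2)) := by ring
      _ ≤ _ := h2
      _ = _ := by ring
  have h4 : 4 * t / 3 ≤ 1 / (4 * t ^ 2) := by linarith
  rw [le_div_iff₀ (by positivity)] at h4
  nlinarith

/-- The positive root `v` of `-x v² + v = x²`. -/
noncomputable def quadraticBarrier (x : ℝ) : ℝ := (1 - Real.sqrt (1 - 4 * x ^ 3)) / (2 * x)

lemma one_lt_sqrt_one_sub {x : ℝ} (hx : x < 0) : 1 < Real.sqrt (1 - 4 * x ^ 3) := by
  rw [Real.lt_sqrt (by norm_num)]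
  have : x ^ 3 < 0 := Odd.pow_neg (by decide) hx
  linarith

lemma sq_sqrt_one_sub {x : ℝ} (hx : x < 0) :
    Real.sqrt (1 - 4 * x ^ 3) ^ 2 = 1 - 4 * x ^ 3 := by
  have : x ^ 3 < 0 := Odd.pow_neg (by decide) hx
  exact Real.sq_sqrt (by linarith)

lemma quadraticBarrier_pos {x : ℝ} (hx : x < 0) : 0 < quadraticBarrier x :=
  div_pos_of_neg_of_neg (by linarith [one_lt_sqrt_one_sub hx]) (by linarith)

lemma quadraticBarrier_eq {x : ℝ} (hx : x < 0) :
    quadraticBarrier x = x * (quadraticBarrier x ^ 2 + x) := by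
  have h := sq_sqrt_one_sub hx
  rw [quadraticBarrier]
  have := hx.ne
  field_simp
  nlinarith

lemma sqrt_eq_quadraticBarrier {x : ℝ} (hx : x < 0) :
    Real.sqrt (1 - 4 * x ^ 3) = 1 - 2 * x * quadraticBarrier x := by
  rw [quadraticBarrier]
  have := hx.ne
  field_simp
  ring

lemma quadraticBarrier_sq {x : ℝ} (hx : x < 0) :
    quadraticBarrier x ^ 2 =
      -x * ((Real.sqrt (1 - 4 * x ^ 3) - 1) / (Real.sqrt (1 - 4 * x ^ 3) + 1)) := by
  have h2 := quadraticBarrier_eq hx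
  have h3 := one_lt_sqrt_one_sub hx
  rw [← mul_div_assoc, eq_div_iff (by linarith), sqrt_eq_quadraticBarrier hx]
  linear_combination 2 * quadraticBarrier x * h2

lemma quadraticBarrier_le {x : ℝ} (hx : x < 0) : quadraticBarrier x ≤ Real.sqrt (-x) := by
  refine Real.le_sqrt_of_sq_le ?_
  have h1 := quadraticBarrier_pos hx
  have h2 := quadraticBarrier_eq hx
  nlinarith

lemma hasDerivAt_sqrt_one_sub {x : ℝ} (hx : x < 0) :
    HasDerivAt (fun x : ℝ => Real.sqrt (1 - 4 * x ^ 3))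
      (-6 * x ^ 2 / Real.sqrt (1 - 4 * x ^ 3)) x := by
  have : x ^ 3 < 0 := Odd.pow_neg (by decide) hx
  refine ((((hasDerivAt_pow 3 x).const_mul 4).const_sub 1).sqrt (by linarith)).congr_deriv ?_
  norm_num
  ring

lemma hasDerivAt_quadraticBarrier {x : ℝ} (hx : x < 0) :
    HasDerivAt quadraticBarrier
      ((2 * x + quadraticBarrier x ^ 2) / Real.sqrt (1 - 4 * x ^ 3)) x := by
  have h3 := one_lt_sqrt_one_sub hx
  have hR : Real.sqrt (1 - 4 * x ^ 3) ≠ 0 := by linarith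
  have hs := sq_sqrt_one_sub hx
  have hx0 := hx.ne
  refine (((hasDerivAt_sqrt_one_sub hx).const_sub 1).fun_div ((hasDerivAt_id x).const_mul 2)
    (by simpa using hx0)).congr_deriv ?_
  rw [quadraticBarrier]
  simp only [id, mul_one]
  generalize Real.sqrt (1 - 4 * x ^ 3) = R at *
  field_simp
  linear_combination hs

/-- `quadraticBarrier` is a subsolution of `u'' = 2xu + 2u³` on `(-∞, 0)`. -/
lemma quadraticBarrier_subsolution {x : ℝ} (hx : x < 0) :
    ∃ b, HasDerivAt
      (fun x => (2 * x + quadraticBarrier x ^ 2) / Real.sqrt (1 - 4 * x ^ 3)) b x ∧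
      2 * quadraticBarrier x * (quadraticBarrier x ^ 2 + x) ≤ b := by
  have h3 := one_lt_sqrt_one_sub hx
  have hR0 : 0 < Real.sqrt (1 - 4 * x ^ 3) := by linarith
  refine ⟨_, ((((hasDerivAt_id x).const_mul 2).add
    ((hasDerivAt_quadraticBarrier hx).pow 2))).div (hasDerivAt_sqrt_one_sub hx) hR0.ne', ?_⟩
  have h1 := quadraticBarrier_pos hx
  have h2 := quadraticBarrier_eq hx
  have hR := sqrt_eq_quadraticBarrier hx
  generalize Real.sqrt (1 - 4 * x ^ 3) = R at *
  simp only [Pi.add_apply, Pi.pow_apply, id]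
  generalize quadraticBarrier x = v at *
  have hx0 := hx.ne
  obtain ⟨Y, hY⟩ : ∃ Y, Y = v ^ 2 / -x := ⟨_, rfl⟩
  have hY0 : 0 < Y := by rw [hY]; exact div_pos (pow_pos h1 2) (by linarith)
  have hv2 : v ^ 2 = -x * Y := by rw [hY]; field_simp
  have hv : v = x ^ 2 * (1 - Y) := by rw [hv2] at h2; linear_combination h2
  have hY1 : 0 < 1 - Y := by
    by_contra! h
    nlinarith [sq_nonneg x]
  have hx3 : x ^ 3 = -(Y / (1 - Y) ^ 2) := by
    have : x * (x ^ 3 * (1 - Y) ^ 2 + Y) = 0 := by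
      have h4 := hv2
      rw [hv] at h4
      linear_combination h4
    have h5 := (mul_eq_zero.1 this).resolve_left hx0
    field_simp
    linear_combination h5
  have hRY : R = (1 + Y) / (1 - Y) := by
    have : R = 1 - 2 * x ^ 3 * (1 - Y) := by rw [hR, hv]; ring
    rw [this, hx3]
    field_simp
    ring
  have e1 : v * (2 * x + v ^ 2) = -(Y * (2 - Y) / (1 - Y)) := by
    have : v * (2 * x + v ^ 2) = x ^ 3 * (1 - Y) * (2 - Y) := by rw [hv2, hv]; ring
    rw [this, hx3]
    field_simp
  have e2 : x ^ 2 * (2 * x + v ^ 2) = -(Y * (2 - Y) / (1 - Y) ^ 2) := by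
    have : x ^ 2 * (2 * x + v ^ 2) = x ^ 3 * (2 - Y) := by rw [hv2]; ring
    rw [this, hx3]
    field_simp
  have e3 : v * (v ^ 2 + x) = -Y := by
    have : v * (v ^ 2 + x) = x ^ 3 * (1 - Y) ^ 2 := by rw [hv2, hv]; ring
    rw [this, hx3]
    field_simp
  have hP : 0 ≤ (1 - Y) * ((1 + Y) ^ 2 - Y * (2 - Y) * (1 + Y) - 3 * Y * (2 - Y))
      + Y * (1 + Y) ^ 3 := by
    nlinarith [sq_nonneg (Y - 1 / 4), sq_nonneg (Y ^ 2 - Y / 4), mul_pos hY0 hY1,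
      mul_nonneg hY0.le (sq_nonneg (Y - 1 / 4))]
  have hP' : 0 ≤ 2 * ((1 - Y) * ((1 + Y) ^ 2 - Y * (2 - Y) * (1 + Y) - 3 * Y * (2 - Y))
      + Y * (1 + Y) ^ 3) / (1 + Y) ^ 3 := by positivity
  have e4 : 2 * v * (v ^ 2 + x) = -(2 * Y) := by linear_combination 2 * e3
  rw [e4, ← sub_nonneg]
  refine hP'.trans_eq ?_
  trans (2 + 2 * (v * (2 * x + v ^ 2)) / R) / R + 6 * (x ^ 2 * (2 * x + v ^ 2)) / R ^ 3 + 2 * Y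
  · rw [e1, e2, hRY]
    field_simp
    ring
  · norm_num
    field_simp
    ring

/-- The second lower bound for the Hastings–McLeod solution. -/
lemma quadraticBarrier_le_solution {u u' u'' : ℝ → ℝ}
    (hd1 : ∀ x, HasDerivAt u (u' x) x) (hd2 : ∀ x, HasDerivAt u' (u'' x) x)
    (hode : ∀ x, u'' x = 2 * x * u x + 2 * (u x) ^ 3) (hpos : ∀ x, 0 < u x)
    (hanti : StrictAnti u)
    (hasymp : Tendsto (fun x : ℝ => u x - Real.sqrt (-x)) atBot (𝓝 0))
    {x : ℝ} (hx : x < 0) : quadraticBarrier x ≤ u x := by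
  by_contra! hlt
  obtain ⟨x₀, hx₀, hmin⟩ := exists_forall_div_le_div
    (continuous_iff_continuousAt.2 fun y => (hd1 y).continuousAt) hpos hanti hasymp
    (fun y hy => (hasDerivAt_quadraticBarrier hy).continuousAt.continuousWithinAt)
    (fun y => quadraticBarrier_pos) (fun y => quadraticBarrier_le) hx hlt
  obtain ⟨b, hb, hsub⟩ := quadraticBarrier_subsolution hx₀
  obtain ⟨-, h2⟩ := deriv_conditions_of_forall_div_le_div hd1 (hd2 x₀)
    (fun y => quadraticBarrier_pos) (fun y => hasDerivAt_quadraticBarrier) hb hx₀ hmin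
  have hv := quadraticBarrier_pos hx₀
  have hl := (hmin x hx).trans_lt ((div_lt_one (quadraticBarrier_pos hx)).2 hlt)
  have hl0 := div_pos (hpos x₀) hv
  have hlt' := (div_lt_one hv).1 hl
  have h3 := (mul_le_mul_of_nonneg_left hsub hl0.le).trans h2
  have h4 : u x₀ / quadraticBarrier x₀ * (2 * quadraticBarrier x₀ * (quadraticBarrier x₀ ^ 2 + x₀))
      = 2 * u x₀ * (quadraticBarrier x₀ ^ 2 + x₀) := by field_simp
  rw [h4, hode] at h3
  have h5 := pow_lt_pow_left₀ hlt' (hpos x₀).le two_ne_zero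
  nlinarith [mul_pos (hpos x₀) (sub_pos.2 h5)]

/-- Both lower bounds for solutions above the Hastings–McLeod solution: if `u₀` is
the Hastings–McLeod solution of `u'' = 2xu + 2u³` (positive, strictly decreasing,
asymptotic to `√(-x)` at `-∞`) and `u` is a solution on `(-∞, ω)` with `u ≥ u₀`,
`u(x) - √(-x) → 0` and `u' → 0` at `-∞`, `u' < 0` for all sufficiently negative `x`,
and `s ↦ u(s)² + s` absolutely integrable on `(-∞, x]` for every `x < ω`, then for all
`x < min(ω, 0)`: `u(x) > √(-x/3)` and
`u(x) ≥ √(-x)·√((√(1-4x³) - 1)/(√(1-4x³) + 1))`. -/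
theorem PII_lower_bounds (u₀ u₀' u₀'' : ℝ → ℝ)
    (h0d1 : ∀ x : ℝ, HasDerivAt u₀ (u₀' x) x)
    (h0d2 : ∀ x : ℝ, HasDerivAt u₀' (u₀'' x) x)
    (h0ode : ∀ x : ℝ, u₀'' x = 2 * x * u₀ x + 2 * (u₀ x) ^ 3)
    (h0pos : ∀ x : ℝ, 0 < u₀ x)
    (h0anti : StrictAnti u₀)
    (h0asymp : Tendsto (fun x : ℝ => u₀ x - Real.sqrt (-x)) atBot (𝓝 0))
    (h0lim : Tendsto u₀' atBot (𝓝 0))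
    (h0int : ∀ x : ℝ, IntegrableOn (fun s : ℝ => (u₀ s) ^ 2 + s) (Set.Iic x))
    (ω : EReal) (u u' u'' : ℝ → ℝ)
    (hd1 : ∀ x : ℝ, (x : EReal) < ω → HasDerivAt u (u' x) x)
    (hd2 : ∀ x : ℝ, (x : EReal) < ω → HasDerivAt u' (u'' x) x)
    (hode : ∀ x : ℝ, (x : EReal) < ω → u'' x = 2 * x * u x + 2 * (u x) ^ 3)
    (hdom : ∀ x : ℝ, (x : EReal) < ω → u₀ x ≤ u x)
    (hasymp : Tendsto (fun x : ℝ => u x - Real.sqrt (-x)) atBot (𝓝 0))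
    (hlim : Tendsto u' atBot (𝓝 0))
    (hneg : ∀ᶠ x in atBot, u' x < 0)
    (hint : ∀ x : ℝ, (x : EReal) < ω →
      IntegrableOn (fun s : ℝ => (u s) ^ 2 + s) (Set.Iic x)) :
    ∀ x : ℝ, (x : EReal) < min ω 0 →
      Real.sqrt (-x / 3) < u x ∧
      Real.sqrt (-x) * Real.sqrt ((Real.sqrt (1 - 4 * x ^ 3) - 1)
        / (Real.sqrt (1 - 4 * x ^ 3) + 1)) ≤ u x := by
  intro x hx
  have hx0 : x < 0 := by exact_mod_cast hx.trans_le (min_le_right _ _)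
  have hle := hdom x (hx.trans_le (min_le_left _ _))
  refine ⟨(sqrt_div_three_lt h0d1 h0d2 h0ode h0pos h0anti h0asymp hx0).trans_le hle, ?_⟩
  refine le_trans ?_
    ((quadraticBarrier_le_solution h0d1 h0d2 h0ode h0pos h0anti h0asymp hx0).trans hle)
  rw [← Real.sqrt_mul (by linarith), ← quadraticBarrier_sq hx0,
    Real.sqrt_sq (quadraticBarrier_pos hx0).le]
end
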